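/- For every natural number n there exists a finite simple graph G such that m(G) - χ_b(G) ≥ n; that is, the difference between m(G) and the b-chromatic number can be arbitrarily large. -/

import Mathlib

open SimpleGraph Finset

/-- A vertex `u` is a b-vertex for the coloring `C` if `u` has a neighbor colored
with each color different from its own. -/
def IsBVertex {V : Type*} (G : SimpleGraph V) {k : ℕ} (C : V → Fin k) (u : V) : Prop :=
  ∀ j : Fin k, j ≠ C u → ∃ w, G.Adj u w ∧ C w = j

/-- A b-coloring of `G` with `k` colors: a proper coloring with colors `Fin k` such that
every color class contains a b-vertex (in particular every color is used). -/
def IsBColoring {V : Type*} (G : SimpleGraph V) (k : ℕ) (C : V → Fin k) : Prop :=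
  (∀ u v, G.Adj u v → C u ≠ C v) ∧
  (∀ i : Fin k, ∃ u, C u = i ∧ IsBVertex G C u)

/-- The b-chromatic number: the largest `k` such that `G` has a b-coloring with `k` colors. -/
noncomputable def bChromatic {V : Type*} (G : SimpleGraph V) : ℕ :=
  sSup {k : ℕ | ∃ C : V → Fin k, IsBColoring G k C}

/-- `m(G)`: the largest `k` such that `G` has at least `k` vertices of degree at least `k - 1`. -/
noncomputable def mParam {V : Type*} [Fintype V] (G : SimpleGraph V) [DecidableRel G.Adj] : ℕ :=
  sSup {k : ℕ | k ≤ (Finset.univ.filter fun v => k - 1 ≤ G.degree v).card}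

/-- The set `M(G)` of dense vertices, i.e. vertices of degree at least `m(G) - 1`. -/
noncomputable def denseSet {V : Type*} [Fintype V] (G : SimpleGraph V) [DecidableRel G.Adj] :
    Finset V :=
  Finset.univ.filter fun v => mParam G - 1 ≤ G.degree v

/-- `W` encircles `u` if every `v ∈ W` is adjacent to `u` or has a common neighbor
`w ∈ W` with `u` such that `deg w = m(G) - 1`. -/
def Encircles {V : Type*} [Fintype V] (G : SimpleGraph V) [DecidableRel G.Adj]
    (W : Finset V) (u : V) : Prop :=
  ∀ v ∈ W, G.Adj u v ∨ ∃ w ∈ W, G.Adj v w ∧ G.Adj u w ∧ G.degree w = mParam G - 1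

/-- A good set: a set `W ⊆ M(G)` of `m(G)` vertices that encircles no vertex outside `W`,
and such that every vertex outside `W` of degree at least `m(G)` has a neighbor in `W`. -/
def IsGoodSet {V : Type*} [Fintype V] (G : SimpleGraph V) [DecidableRel G.Adj]
    (W : Finset V) : Prop :=
  W.card = mParam G ∧
  (∀ v ∈ W, mParam G - 1 ≤ G.degree v) ∧
  (∀ u, u ∉ W → ¬ Encircles G W u) ∧
  (∀ x, x ∉ W → mParam G ≤ G.degree x → ∃ w ∈ W, G.Adj x w)

/-- A b-coloring of a complete bipartite graph uses at most two colors: two b-vertices of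
different colors cannot lie on the same side. -/
theorem bChromatic_completeBipartiteGraph_le_two (V W : Type*) :
    bChromatic (completeBipartiteGraph V W) ≤ 2 := by
  refine csSup_le' ?_
  rintro k ⟨C, hC, hb⟩
  choose u hu hbu using hb
  have hinj : Function.Injective fun i => (u i).isLeft := by
    intro i j hij
    by_contra hne
    change (u i).isLeft = (u j).isLeft at hij
    obtain ⟨w, hw, hwj⟩ := hbu i j (by rw [hu]; exact Ne.symm hne)
    refine hC (u j) w ?_ (by rw [hu, hwj])
    revert hw hij
    rcases u i with a | a <;> rcases u j with b | b <;> rcases w with c | c <;>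
      simp
  simpa using Fintype.card_le_of_injective _ hinj

theorem le_mParam {V : Type*} [Fintype V] (G : SimpleGraph V) [DecidableRel G.Adj] {k : ℕ}
    (h : k ≤ (Finset.univ.filter fun v => k - 1 ≤ G.degree v).card) : k ≤ mParam G :=
  le_csSup ⟨Fintype.card V, fun _ hk => hk.trans (Finset.card_le_univ _)⟩ h

/-- In a complete bipartite graph with both sides of size `N ≥ 1`, every vertex has degree `N`
and there are at least `N + 1` vertices. -/
theorem succ_le_mParam_completeBipartiteGraph {N : ℕ} (hN : 1 ≤ N)
    [DecidableRel (completeBipartiteGraph (Fin N) (Fin N)).Adj] :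
    N + 1 ≤ mParam (completeBipartiteGraph (Fin N) (Fin N)) := by
  have hdeg (v : Fin N ⊕ Fin N) : N ≤ (completeBipartiteGraph (Fin N) (Fin N)).degree v := by
    rw [← SimpleGraph.card_neighborFinset_eq_degree]
    nth_rw 1 [← Finset.card_fin N]
    rcases v with a | a
    · exact Finset.card_le_card_of_injOn Sum.inr (by intro b _; simp) Sum.inr_injective.injOn
    · exact Finset.card_le_card_of_injOn Sum.inl (by intro b _; simp) Sum.inl_injective.injOn
  refine le_mParam _ ?_
  rw [Finset.filter_true_of_mem fun v _ => by simpa using hdeg v]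
  simp
  omega

/-- The difference `m(G) - χ_b(G)` can be arbitrarily large. -/
theorem mParam_sub_bChromatic_unbounded (n : ℕ) :
    ∃ (V : Type) (_ : Fintype V) (G : SimpleGraph V) (_ : DecidableRel G.Adj),
      n ≤ mParam G - bChromatic G := by
  classical
  refine ⟨Fin (n + 1) ⊕ Fin (n + 1), inferInstance,
    completeBipartiteGraph (Fin (n + 1)) (Fin (n + 1)), inferInstance, ?_⟩
  have hm := succ_le_mParam_completeBipartiteGraph (N := n + 1) (by omega)
  have hb := bChromatic_completeBipartiteGraph_le_two (Fin (n + 1)) (Fin (n + 1))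
  omega
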